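/- Let K be a field of characteristic 0 and let 0 < t < k ≤ n be integers with binom(n,t) < binom(n,k). Let φ : K[c_κ : κ a k-subset of {1,…,n}] → K[x_τ : τ a t-subset of {1,…,n}] be the K-algebra homomorphism between polynomial rings sending c_κ ↦ ∏_{τ ⊆ κ, |τ| = t} x_τ, and let I_{n,k,t} = ker(φ) be the incidence toric ideal. Then the ℚ-vector space {v ∈ ℚ^{k-subsets} : 𝒜_{n,k,t}·v = 0} has dimension binom(n,k) − binom(n,t), the height of I_{n,k,t} equals binom(n,k) − binom(n,t), and the Krull dimension of the quotient ring K[c_κ]/I_{n,k,t} equals binom(n,t). -/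

import Mathlib

open MvPolynomial

/-- The incidence matrix `𝒜_{n,k,t}`: rows indexed by `t`-subsets `T` of `{1,…,n}`,
columns indexed by `k`-subsets `K`, with entry `1` if `T ⊆ K` and `0` otherwise. -/
def incMat (R : Type*) [Zero R] [One R] (n k t : ℕ) :
    Matrix {T : Finset (Fin n) // T.card = t} {K : Finset (Fin n) // K.card = k} R :=
  fun T K => if T.1 ⊆ K.1 then 1 else 0

/-- The monomial map `φ : K[c_κ] → K[x_τ]`, `c_κ ↦ ∏_{τ ⊆ κ, |τ| = t} x_τ`. -/
noncomputable def incMap (K : Type*) [Field K] (n k t : ℕ) :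
    MvPolynomial {κ : Finset (Fin n) // κ.card = k} K →ₐ[K]
      MvPolynomial {τ : Finset (Fin n) // τ.card = t} K :=
  aeval fun κ =>
    ∏ τ ∈ Finset.univ.filter (fun τ : {τ : Finset (Fin n) // τ.card = t} => τ.1 ⊆ κ.1), X τ

/-- The height of an ideal: the infimum of the heights (in the poset of prime
ideals) of the primes containing it. -/
noncomputable def idealHeight {S : Type*} [CommRing S] (I : Ideal S) : ℕ∞ :=
  ⨅ (P : PrimeSpectrum S) (_ : I ≤ P.asIdeal), Order.height P

/-- Gottlieb's theorem: injectivity of the transposed incidence matrix. -/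
lemma gott_up (n k t : ℕ) (htk : t ≤ k)
    (f : {T : Finset (Fin n) // T.card = t} → ℚ)
    (hf : ∀ S : Finset (Fin n), S.card = k → ∑ T, (if T.1 ⊆ S then f T else 0) = 0) :
    ∀ m, k ≤ m → ∀ S : Finset (Fin n), S.card = m →
      ∑ T, (if T.1 ⊆ S then f T else 0) = 0 := by
  intro m hm
  induction m, hm using Nat.le_induction with
  | base => exact hf
  | succ m hm ih =>
    intro S hS
    have h1 : ∑ i ∈ S, ∑ T, (if T.1 ⊆ S.erase i then f T else 0) = 0 := by
      apply Finset.sum_eq_zero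
      intro i hi
      apply ih
      rw [Finset.card_erase_of_mem hi, hS]; rfl
    rw [Finset.sum_comm] at h1
    have h2 : ∀ T : {T : Finset (Fin n) // T.card = t},
        ∑ i ∈ S, (if T.1 ⊆ S.erase i then f T else 0)
          = ((m + 1 - t : ℕ) : ℚ) * (if T.1 ⊆ S then f T else 0) := by
      intro T
      by_cases hT : T.1 ⊆ S
      · rw [← Finset.sum_filter]
        have : S.filter (fun i => T.1 ⊆ S.erase i) = S \ T.1 := by
          ext i
          simp only [Finset.mem_filter, Finset.mem_sdiff, Finset.subset_erase]
          tauto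
        rw [this, Finset.sum_const, Finset.card_sdiff_of_subset hT, hS, T.2, nsmul_eq_mul,
          if_pos hT]
      · rw [if_neg hT, mul_zero]
        apply Finset.sum_eq_zero
        intro i _
        rw [if_neg]
        intro h
        exact hT (h.trans (Finset.erase_subset _ _))
    rw [Finset.sum_congr rfl (fun T _ => h2 T), ← Finset.mul_sum] at h1
    rcases mul_eq_zero.1 h1 with h | h
    · have : m + 1 - t = 0 := by exact_mod_cast h
      omega
    · exact h

lemma gottlieb (n k t : ℕ) (htk : t ≤ k) (hkn : k + t ≤ n)
    (f : {T : Finset (Fin n) // T.card = t} → ℚ)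
    (hf : ∀ S : Finset (Fin n), S.card = k → ∑ T, (if T.1 ⊆ S then f T else 0) = 0) :
    f = 0 := by
  funext S
  have h0 : ∑ R ∈ S.1.powerset, (-1 : ℚ) ^ R.card *
      ∑ T, (if T.1 ⊆ Rᶜ then f T else 0) = 0 := by
    apply Finset.sum_eq_zero
    intro R hR
    rw [gott_up n k t htk f hf _ _ Rᶜ rfl, mul_zero]
    have := Finset.card_le_card (Finset.mem_powerset.1 hR)
    rw [Finset.card_compl, Fintype.card_fin]
    have := S.2
    omega
  simp_rw [Finset.mul_sum] at h0
  rw [Finset.sum_comm] at h0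
  have h2 : ∀ T : {T : Finset (Fin n) // T.card = t},
      ∑ R ∈ S.1.powerset, (-1 : ℚ) ^ R.card * (if T.1 ⊆ Rᶜ then f T else 0)
        = if T = S then f T else 0 := by
    intro T
    have e1 : ∑ R ∈ S.1.powerset, (-1 : ℚ) ^ R.card * (if T.1 ⊆ Rᶜ then f T else 0)
        = (∑ R ∈ (S.1 \ T.1).powerset, (-1 : ℚ) ^ R.card) * f T := by
      have : (S.1 \ T.1).powerset = S.1.powerset.filter (fun R => T.1 ⊆ Rᶜ) := by
        ext R
        simp only [Finset.mem_powerset, Finset.mem_filter, Finset.subset_sdiff,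
          Finset.subset_compl_iff_disjoint_right]
        rw [disjoint_comm]
      rw [this, Finset.sum_filter, Finset.sum_mul]
      apply Finset.sum_congr rfl
      intro R _
      split_ifs <;> simp
    have e2 : (∑ R ∈ (S.1 \ T.1).powerset, (-1 : ℚ) ^ R.card)
        = if S.1 \ T.1 = ∅ then 1 else 0 := by
      have := Finset.sum_powerset_neg_one_pow_card (x := S.1 \ T.1)
      exact_mod_cast congrArg (Int.cast : ℤ → ℚ) this
    rw [e1, e2]
    have e3 : S.1 \ T.1 = ∅ ↔ T = S := by
      rw [Finset.sdiff_eq_empty_iff_subset]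
      constructor
      · intro h
        exact Subtype.ext (Finset.eq_of_subset_of_card_le h (by rw [T.2, S.2])).symm
      · rintro rfl; exact Finset.Subset.refl _
    simp only [e3]
    split_ifs <;> simp
  rw [Finset.sum_congr rfl (fun T _ => h2 T)] at h0
  simpa using h0

lemma choose_arith (n k t : ℕ) (htk : t < k) (hkn : k ≤ n)
    (h : n.choose t < n.choose k) : k + t ≤ n := by
  by_contra hc
  push Not at hc
  have h1 : n.choose k = n.choose (n - k) := (Nat.choose_symm hkn).symm
  -- reduce to a set at most the middle
  have mono : ∀ a b, a ≤ b → b ≤ n / 2 → n.choose a ≤ n.choose b := by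
    intro a b hab
    induction b, hab using Nat.le_induction with
    | base => intro _; rfl
    | succ m hm ih =>
      intro hb
      exact (ih (by omega)).trans (Nat.choose_le_succ_of_lt_half_left (by omega))
  by_cases ht : t ≤ n / 2
  · have := mono (n - k) t (by omega) ht
    omega
  · have h2 : n.choose t = n.choose (n - t) := (Nat.choose_symm (by omega)).symm
    have := mono (n - k) (n - t) (by omega) (by omega)
    omega

lemma card_sub (n t : ℕ) : Fintype.card {T : Finset (Fin n) // T.card = t} = n.choose t := by
  simp

lemma rows_li (n k t : ℕ) (htk : t ≤ k) (hkn : k + t ≤ n) :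
    LinearIndependent ℚ (incMat ℚ n k t).row := by
  rw [Fintype.linearIndependent_iff]
  intro g hg
  have := gottlieb n k t htk hkn g (by
    intro S hS
    have := congrFun hg ⟨S, hS⟩
    simpa [incMat, Matrix.row] using this)
  intro i
  rw [this]; rfl

lemma inc_rank (n k t : ℕ) (htk : t ≤ k) (hkn : k + t ≤ n) :
    (incMat ℚ n k t).rank = n.choose t := by
  rw [(rows_li n k t htk hkn).rank_matrix, card_sub]

lemma inc_ker (n k t : ℕ) (htk : t ≤ k) (hkn : k + t ≤ n) :
    Module.finrank ℚ (LinearMap.ker (incMat ℚ n k t).mulVecLin)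
        = n.choose k - n.choose t := by
  have := LinearMap.finrank_range_add_finrank_ker (incMat ℚ n k t).mulVecLin
  have h2 := inc_rank n k t htk hkn
  rw [Matrix.rank] at h2
  rw [h2, Module.finrank_fintype_fun_eq_card, card_sub] at this
  omega

lemma inc_cols (n k t : ℕ) (htk : t ≤ k) (hkn : k + t ≤ n) :
    ∃ (B : Type) (_ : Fintype B) (a : B → {κ : Finset (Fin n) // κ.card = k}),
      Function.Injective a ∧ Fintype.card B = n.choose t ∧
      LinearIndependent ℚ (fun b => (incMat ℚ n k t).col (a b)) := by
  obtain ⟨B, a, ha, hs, hl⟩ := exists_linearIndependent' ℚ (incMat ℚ n k t).col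
  have : Finite B := Finite.of_injective a ha
  letI := Fintype.ofFinite B
  refine ⟨B, inferInstance, a, ha, ?_, hl⟩
  have h1 := finrank_span_eq_card hl
  rw [hs, ← Matrix.rank_eq_finrank_span_cols, inc_rank n k t htk hkn] at h1
  exact h1.symm

section general
variable {K : Type*} [Field K]

/-- Monomials with linearly independent exponents are algebraically independent. -/
lemma algInd_monomial {τ B : Type*} [Fintype B] (e : B → τ →₀ ℕ)
    (he : LinearIndependent ℚ (fun b => fun i => ((e b i : ℕ) : ℚ))) :
    AlgebraicIndependent K (fun b => (monomial (e b) (1 : K) : MvPolynomial τ K)) := by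
  rw [algebraicIndependent_iff_injective_aeval]
  let L : (B →₀ ℕ) → (τ →₀ ℕ) := fun m => ∑ b, m b • e b
  have hL : Function.Injective L := by
    intro m m' h
    have := Fintype.linearIndependent_iff.1 he (fun b => (m b : ℚ) - m' b) (by
      funext i
      have := congrArg (fun z : τ →₀ ℕ => ((z i : ℕ) : ℚ)) h
      simp only [L, Finsupp.coe_finsetSum, Finset.sum_apply, Finsupp.smul_apply, smul_eq_mul,
        Nat.cast_sum, Nat.cast_mul] at this
      simp only [Finset.sum_apply, Pi.smul_apply, smul_eq_mul, sub_mul, Finset.sum_sub_distrib,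
        Pi.zero_apply]
      linarith)
    ext b
    have := this b
    have : (m b : ℚ) = m' b := by linarith
    exact_mod_cast this
  have hm : ∀ m : B →₀ ℕ, aeval (fun b => (monomial (e b) (1 : K) : MvPolynomial τ K))
      (monomial m (1 : K)) = monomial (L m) 1 := by
    intro m
    rw [aeval_monomial, map_one, one_mul, Finsupp.prod_fintype _ _ (by simp)]
    simp only [monomial_pow, one_pow, L]
    rw [monomial_sum_one]
  have hm' : ∀ (m : B →₀ ℕ) (c : K),
      aeval (fun b => (monomial (e b) (1 : K) : MvPolynomial τ K))
      (monomial m c) = monomial (L m) c := by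
    intro m c
    have h1 : (monomial m c : MvPolynomial B K) = c • monomial m 1 := by
      rw [smul_monomial, smul_eq_mul, mul_one]
    rw [h1, map_smul, hm, smul_monomial, smul_eq_mul, mul_one]
  have hc : ∀ (p : MvPolynomial B K) (m₀ : B →₀ ℕ), coeff (L m₀)
      (aeval (fun b => (monomial (e b) (1 : K) : MvPolynomial τ K)) p) = coeff m₀ p := by
    intro p m₀
    induction p using MvPolynomial.induction_on' with
    | monomial m c =>
      classical
      rw [hm', coeff_monomial, coeff_monomial]
      simp only [hL.eq_iff]
    | add p q hp hq => rw [map_add, coeff_add, coeff_add, hp, hq]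
  intro p q hpq
  ext m
  rw [← hc p m, ← hc q m, hpq]

variable {σ A : Type*} [Fintype σ] [CommRing A] [IsDomain A] [Algebra K A]

open Classical in
/-- Partial specialization: `X i ↦ y i` for `i ∈ S`, the others stay variables. -/
noncomputable def partMap (y : σ → A) (S : Finset σ) :
    MvPolynomial σ K →ₐ[K] MvPolynomial σ A :=
  aeval fun i => if i ∈ S then C (y i) else X i

/-- Its kernel as a point of the spectrum. -/
noncomputable def partPrime (y : σ → A) (S : Finset σ) :
    PrimeSpectrum (MvPolynomial σ K) :=
  ⟨RingHom.ker (partMap (K := K) y S), RingHom.ker_isPrime _⟩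

lemma partPrime_le (y : σ → A) {S S' : Finset σ} (h : S ⊆ S') :
    partPrime (K := K) y S ≤ partPrime y S' := by
  classical
  let ψ : MvPolynomial σ A →ₐ[A] MvPolynomial σ A :=
    aeval fun i => if i ∈ S' then C (y i) else X i
  have : partMap (K := K) y S' = (ψ.restrictScalars K).comp (partMap y S) := by
    apply MvPolynomial.algHom_ext
    intro i
    simp only [partMap, aeval_X, AlgHom.comp_apply, AlgHom.restrictScalars_apply, ψ]
    by_cases hi : i ∈ S
    · rw [if_pos (h hi), if_pos hi]
      exact (aeval_C _ _).symm
    · rw [if_neg hi]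
      simp
  intro p hp
  change p ∈ RingHom.ker (partMap (K := K) y S')
  replace hp : p ∈ RingHom.ker (partMap (K := K) y S) := hp
  rw [RingHom.mem_ker] at hp ⊢
  rw [this, AlgHom.comp_apply, hp, map_zero]

lemma partPrime_lt (y : σ → A) {B : Type*} (a : B → σ)
    (hB : IsTranscendenceBasis K (y ∘ a)) {S : Finset σ} (hS : ∀ b, a b ∈ S) {j : σ}
    (hj : j ∉ S) (S' : Finset σ) (hSS' : S ⊆ S') (hjS' : j ∈ S') :
    partPrime (K := K) y S < partPrime y S' := by
  classical
  refine lt_of_le_not_ge (partPrime_le y hSS') fun hle => ?_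
  -- an algebraic relation
  have halg : ¬ AlgebraicIndependent K (fun o : Option B => o.elim (y j) (y ∘ a)) := by
    rw [hB.1.option_iff_transcendental]
    have := hB.isAlgebraic
    exact fun h => h (Algebra.IsAlgebraic.isAlgebraic _)
  have hind : AlgebraicIndependent K
      (fun o : Option B => o.elim (X j : MvPolynomial σ A) (fun b => C (y (a b)))) := by
    have h1 := AlgebraicIndependent.sumElim_comp hB.1
      (MvPolynomial.algebraicIndependent_X σ A)
    have h2 := h1.comp (fun o : Option B => o.elim (Sum.inl j) Sum.inr) (by
      intro o o' h
      cases o <;> cases o' <;> simp_all)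
    convert! h2 using 1
    funext o
    cases o <;> simp [MvPolynomial.algebraMap_eq]
  apply halg
  rw [algebraicIndependent_iff]
  intro p hp
  let r : MvPolynomial σ K := rename (fun o : Option B => o.elim j a) p
  have hr : r ∈ RingHom.ker (partMap (K := K) y S') := by
    rw [RingHom.mem_ker, partMap, aeval_rename]
    have : ((fun i => if i ∈ S' then C (y i) else X i) ∘ fun o : Option B => o.elim j a)
        = fun o => algebraMap A (MvPolynomial σ A) (o.elim (y j) (y ∘ a)) := by
      funext o
      cases o with
      | none => simp [hjS']
      | some b => simp [hSS' (hS b)]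
    rw [this]
    have h3 := aeval_algebraMap_apply (MvPolynomial σ A)
      (fun o : Option B => o.elim (y j) (y ∘ a)) p
    exact h3.trans (by rw [hp, map_zero])
  have hr2 : r ∈ RingHom.ker (partMap (K := K) y S) := hle hr
  rw [RingHom.mem_ker, partMap, aeval_rename] at hr2
  refine (algebraicIndependent_iff.1 hind) p ?_
  rw [← hr2]
  congr 2
  funext o
  cases o with
  | none => simp [hj]
  | some b => simp [hS b]

lemma partPrime_height (y : σ → A) {B : Type*} [Fintype B] (a : B → σ)
    (ha : Function.Injective a)
    (hB : IsTranscendenceBasis K (y ∘ a)) :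
    ((Fintype.card σ - Fintype.card B : ℕ) : ℕ∞) ≤ Order.height
      (partPrime (K := K) y Finset.univ) := by
  classical
  have key : ∀ (U : Finset σ), (∀ b, a b ∉ U) →
      (U.card : ℕ∞) ≤ Order.height (partPrime (K := K) y (Finset.univ.image a ∪ U)) := by
    intro U
    induction U using Finset.induction_on with
    | empty => simp
    | insert j U hj ih =>
      intro hU
      have h1 := ih (fun b hb => hU b (Finset.mem_insert_of_mem hb))
      have h2 := partPrime_lt (K := K) y a hB (S := Finset.univ.image a ∪ U)
        (by intro b; simp) (j := j)
        (by
          simp only [Finset.mem_union, Finset.mem_image, Finset.mem_univ, true_and, not_or,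
            not_exists]
          refine ⟨fun b hb => hU b (by simp [hb]), hj⟩)
        (Finset.univ.image a ∪ insert j U)
        (Finset.union_subset_union_right (Finset.subset_insert _ _)) (by simp)
      rw [Finset.card_insert_of_notMem hj]
      push_cast
      exact (add_le_add_left h1 1).trans (Order.height_add_one_le h2)
  have := key (Finset.univ \ Finset.univ.image a) (by simp)
  rw [Finset.union_sdiff_of_subset (Finset.subset_univ _),
    Finset.card_sdiff_of_subset (Finset.subset_univ _), Finset.card_univ,
    Finset.card_image_of_injective _ ha, Finset.card_univ] at this
  exact this

lemma partPrime_univ (y : σ → A) :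
    (partPrime (K := K) y Finset.univ).asIdeal = RingHom.ker (aeval (R := K) y) := by
  have : partMap (K := K) y Finset.univ
      = (IsScalarTower.toAlgHom K A (MvPolynomial σ A)).comp (aeval y) := by
    apply MvPolynomial.algHom_ext
    intro i
    simp [partMap, MvPolynomial.algebraMap_eq]
  change RingHom.ker (partMap (K := K) y Finset.univ) = _
  ext p
  rw [RingHom.mem_ker, RingHom.mem_ker, this, AlgHom.comp_apply]
  exact map_eq_zero_iff (C : A →+* MvPolynomial σ A) (MvPolynomial.C_injective σ A)

lemma dim_ge_of_integral {R S : Type*} [CommRing R] [IsDomain R] [CommRing S] [IsDomain S]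
    (g : R →+* S) (hg : Function.Injective g) (hi : g.IsIntegral) :
    ringKrullDim R ≤ ringKrullDim S := by
  letI := g.toAlgebra
  have : Algebra.IsIntegral R S := ⟨hi⟩
  have : FaithfulSMul R S := (faithfulSMul_iff_algebraMap_injective R S).2 hg
  apply iSup_le
  intro l
  obtain ⟨⟨P, hP, hPo⟩⟩ := Ideal.nonempty_primesOver (S := S) l.head.asIdeal
  obtain ⟨L, hL, -⟩ := Ideal.exists_ltSeries_of_hasGoingUp (S := S) l P
  rw [← hL]
  exact le_iSup (fun p : LTSeries (PrimeSpectrum S) => (p.length : WithBot ℕ∞)) L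

lemma dim_quot_ge (P : Ideal (MvPolynomial σ K)) [P.IsPrime] {B : Type*} [Fintype B]
    (z : B → MvPolynomial σ K ⧸ P) (hz : AlgebraicIndependent K z) :
    ((Fintype.card B : ℕ) : WithBot ℕ∞) ≤ ringKrullDim (MvPolynomial σ K ⧸ P) := by
  obtain ⟨s, g, hg, hi⟩ := exists_integral_inj_algHom_of_fg K (MvPolynomial σ K ⧸ P)
  refine le_trans ?_ (dim_ge_of_integral g.toRingHom hg hi)
  have hdim : ringKrullDim (MvPolynomial (Fin s) K) = s := by simp
  rw [hdim]
  have hAlg : Algebra.IsAlgebraic (Algebra.adjoin K (Set.range fun i => g (X i)))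
      (MvPolynomial σ K ⧸ P) := by
    have hmem : ∀ q, g q ∈ Algebra.adjoin K (Set.range fun i => g (X i)) := by
      intro q
      have : g = aeval fun i => g (X i) := MvPolynomial.algHom_ext (by intro i; simp)
      rw [Algebra.adjoin_range_eq_range_aeval, ← this]
      exact ⟨q, rfl⟩
    constructor
    intro x
    obtain ⟨p, hpm, hp⟩ := hi x
    have hint : IsIntegral (Algebra.adjoin K (Set.range fun i => g (X i))) x := by
      refine ⟨p.map (g.codRestrict _ hmem).toRingHom, hpm.map _, ?_⟩
      rw [Polynomial.eval₂_map]
      exact hp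
    exact hint.isAlgebraic
  have h1 := Algebra.IsAlgebraic.trdeg_le_cardinalMk K (Set.range fun i => g (X i))
  have h2 := hz.lift_cardinalMk_le_trdeg
  have h3 : Cardinal.mk (Set.range fun i => g (X i)) ≤ s := by
    have := Cardinal.mk_range_le_lift (f := fun i => g (X i))
    simpa using this
  have h4 := h2.trans (Cardinal.lift_le.2 (h1.trans h3))
  have h5 : Fintype.card B ≤ s := by simpa using h4
  exact_mod_cast h5

lemma height_add_dim_le (P : PrimeSpectrum (MvPolynomial σ K)) :
    (Order.height P : WithBot ℕ∞) + ringKrullDim (MvPolynomial σ K ⧸ P.asIdeal)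
      ≤ Fintype.card σ := by
  have h1 : ringKrullDim (MvPolynomial σ K) = Fintype.card σ := by simp
  rw [← h1, ringKrullDim_quotient]
  have h2 : PrimeSpectrum.zeroLocus (P.asIdeal : Set (MvPolynomial σ K)) = Set.Ici P := by
    ext Q; rfl
  rw [h2, ← Order.coheight_eq_krullDim_Ici, ringKrullDim,
    Order.krullDim_eq_iSup_height_add_coheight_of_nonempty]
  exact_mod_cast le_iSup (fun a => Order.height a + Order.coheight a) P

lemma toric_general (y : σ → A) {B : Type*} [Fintype B] (a : B → σ)
    (ha : Function.Injective a)
    (hB : IsTranscendenceBasis K (y ∘ a)) :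
    idealHeight (RingHom.ker (aeval (R := K) y)) = (Fintype.card σ - Fintype.card B : ℕ) ∧
    ringKrullDim (MvPolynomial σ K ⧸ RingHom.ker (aeval (R := K) y)) = Fintype.card B := by
  have hP : (RingHom.ker (aeval (R := K) y)).IsPrime := RingHom.ker_isPrime _
  have hht : idealHeight (RingHom.ker (aeval (R := K) y))
      = Order.height (partPrime (K := K) y Finset.univ) := by
    apply le_antisymm
    · rw [idealHeight]
      exact iInf₂_le (partPrime (K := K) y Finset.univ) (partPrime_univ (K := K) y).ge
    · rw [idealHeight]
      refine le_iInf₂ fun Q hQ => Order.height_mono ?_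
      change (partPrime (K := K) y Finset.univ).asIdeal ≤ Q.asIdeal
      rw [partPrime_univ]; exact hQ
  have h1 := partPrime_height (K := K) y a ha hB
  have h2 := height_add_dim_le (partPrime (K := K) y Finset.univ)
  rw [partPrime_univ, ← hht] at h2
  rw [← hht] at h1
  have h3 := dim_quot_ge (RingHom.ker (aeval (R := K) y))
    (fun b : B => Ideal.Quotient.mkₐ K _ (X (a b))) (by
      refine AlgebraicIndependent.of_comp (Ideal.kerLiftAlg (aeval (R := K) y)) ?_
      convert! hB.1 using 1
      funext b
      simp only [Function.comp_apply, Ideal.Quotient.mkₐ_eq_mk, Ideal.kerLiftAlg_mk, aeval_X])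
  have h4 : Fintype.card B ≤ Fintype.card σ := Fintype.card_le_of_injective a ha
  generalize idealHeight (RingHom.ker (aeval (R := K) y)) = u at *
  generalize ringKrullDim (MvPolynomial σ K ⧸ RingHom.ker (aeval (R := K) y)) = v at *
  generalize Fintype.card B = d at *
  generalize Fintype.card σ = N at *
  clear hht hB
  induction v with
  | bot => simp at h3
  | coe v =>
    norm_cast at *
    induction v with
    | top => simp at h2
    | coe v =>
      induction u with
      | top => simp at h2
      | coe u =>
        norm_cast at *
        omega

end general
/-- For `0 < t < k ≤ n` with `binom(n,t) < binom(n,k)`: the rational kernel of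
`𝒜_{n,k,t}` has dimension `binom(n,k) − binom(n,t)`, the height of the incidence
toric ideal `I_{n,k,t} = ker φ` is `binom(n,k) − binom(n,t)`, and the Krull
dimension of the quotient ring is `binom(n,t)`. -/
theorem stmt_2 (K : Type*) [Field K] [CharZero K] (n k t : ℕ)
    (ht : 0 < t) (htk : t < k) (hkn : k ≤ n)
    (hchoose : n.choose t < n.choose k) :
    Module.finrank ℚ (LinearMap.ker (incMat ℚ n k t).mulVecLin)
        = n.choose k - n.choose t ∧
    idealHeight (RingHom.ker (incMap K n k t)) = (n.choose k - n.choose t : ℕ) ∧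
    ringKrullDim
        (MvPolynomial {κ : Finset (Fin n) // κ.card = k} K ⧸
          RingHom.ker (incMap K n k t)) = (n.choose t : ℕ) := by
  have hle := choose_arith n k t htk hkn hchoose
  refine ⟨inc_ker n k t htk.le hle, ?_⟩
  obtain ⟨B, _, a, ha, hcard, hli⟩ := inc_cols n k t htk.le hle
  let e : {κ : Finset (Fin n) // κ.card = k} → ({τ : Finset (Fin n) // τ.card = t} →₀ ℕ) :=
    fun κ => ∑ τ ∈ Finset.univ.filter
      (fun τ : {τ : Finset (Fin n) // τ.card = t} => τ.1 ⊆ κ.1), Finsupp.single τ 1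
  have he : ∀ κ τ, e κ τ = if τ.1 ⊆ κ.1 then 1 else 0 := by
    intro κ τ
    simp [e, Finsupp.single_apply, Finset.sum_ite_eq']
  have hy : ∀ κ : {κ : Finset (Fin n) // κ.card = k},
      ∏ τ ∈ Finset.univ.filter (fun τ : {τ : Finset (Fin n) // τ.card = t} => τ.1 ⊆ κ.1),
        (X τ : MvPolynomial {τ : Finset (Fin n) // τ.card = t} K) = monomial (e κ) 1 := by
    intro κ
    simp only [e]
    rw [monomial_sum_one]
    rfl
  have hind : AlgebraicIndependent K
      ((fun κ => (monomial (e κ) 1 : MvPolynomial {τ : Finset (Fin n) // τ.card = t} K)) ∘ a) := by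
    refine algInd_monomial (fun b => e (a b)) ?_
    convert! hli using 1
    funext b τ
    rw [he]
    simp [incMat, Matrix.col]
  have hB := hind.isTranscendenceBasis_of_lift_trdeg_le_of_finite (by
    rw [MvPolynomial.trdeg_of_isDomain]
    simp [hcard])
  have hmap : incMap K n k t = aeval fun κ => monomial (e κ) 1 := by
    rw [incMap]
    congr 1
    funext κ
    exact hy κ
  have := toric_general (K := K) _ a ha hB
  rw [hcard, card_sub] at this
  rw [hmap]
  exact this
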